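/- Let G = (V,E) be a finite connected simple graph with nullity n = |E| - |V| + 1. Then 2^n ≤ |{s ⊆ E : the spanning subgraph (V,s) has no vertex of degree 1}| ≤ ((5-√5)/2)^{n-1} + ((5+√5)/2)^{n-1}, where the upper bound's powers with integer exponent n-1 are taken in ℝ (zpow) and the cardinality is compared with these real numbers. -/

import Mathlib

/-- The degree of vertex `i` in the spanning subgraph `(V, s)`. -/
def degIn {V : Type*} [DecidableEq V] (s : Finset (Sym2 V)) (i : V) : ℕ :=
  (s.filter (fun e => i ∈ e)).card

/-- A vertex labelling that agrees across every edge of a connected graph is constant. -/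
theorem SimpleGraph.Connected.eq_of_forall_adj_eq {V α : Type*} {G : SimpleGraph V}
    (hconn : G.Connected) {σ : V → α} (h : ∀ i j, G.Adj i j → σ i = σ j) (i j : V) :
    σ i = σ j := by
  obtain ⟨p⟩ := hconn.preconnected i j
  induction p with
  | nil => rfl
  | cons hadj _ ih => exact (h _ _ hadj).trans ih

theorem prod_ite_mem_sym2 {V : Type*} [Fintype V] [DecidableEq V] (r : V → ℝ) {u v : V}
    (huv : u ≠ v) : ∏ i : V, (if i ∈ s(u, v) then r i else 1) = r u * r v := by
  rw [← Finset.prod_pair huv, ← Finset.prod_filter]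
  congr 1
  ext i
  simp

theorem prod_pow_degIn {V : Type*} [Fintype V] [DecidableEq V] (r : V → ℝ)
    (s : Finset (Sym2 V)) :
    ∏ i, r i ^ degIn s i = ∏ e ∈ s, ∏ i, (if i ∈ e then r i else 1) := by
  rw [Finset.prod_comm]
  refine Finset.prod_congr rfl fun i _ => ?_
  rw [← Finset.prod_filter, Finset.prod_const, degIn]

/-- Only the two constant labellings contribute to the expansion of the product over the vertices,
because `1 + x * y = 0`. -/
theorem sum_prod_add_pow_degIn {V : Type*} [Fintype V] [DecidableEq V]
    (G : SimpleGraph V) [DecidableRel G.Adj] (hconn : G.Connected)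
    (a b x y : ℝ) (hxy : x * y = -1) :
    ∑ s ∈ G.edgeFinset.powerset, ∏ i, (a * x ^ degIn s i + b * y ^ degIn s i)
      = a ^ Fintype.card V * (1 + x ^ 2) ^ G.edgeFinset.card
        + b ^ Fintype.card V * (1 + y ^ 2) ^ G.edgeFinset.card := by
  obtain ⟨v₀⟩ := hconn.nonempty
  let w : Bool → ℝ := fun c => if c then a else b
  let r : Bool → ℝ := fun c => if c then x else y
  have expand : ∀ s : Finset (Sym2 V),
      ∏ i, (a * x ^ degIn s i + b * y ^ degIn s i)
        = ∑ σ : V → Bool, (∏ i, w (σ i)) *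
            ∏ e ∈ s, ∏ i, (if i ∈ e then r (σ i) else 1) := by
    intro s
    have h : ∀ i, a * x ^ degIn s i + b * y ^ degIn s i
        = ∑ c : Bool, w c * r c ^ degIn s i := by
      intro i
      simp [w, r]
    simp_rw [h]
    rw [Finset.prod_univ_sum, Fintype.piFinset_univ]
    refine Finset.sum_congr rfl fun σ _ => ?_
    rw [Finset.prod_mul_distrib, prod_pow_degIn fun i => r (σ i)]
  simp_rw [expand]
  rw [Finset.sum_comm]
  simp_rw [← Finset.mul_sum, ← Finset.prod_one_add]
  have hconst : ∀ c : Bool,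
      (∏ _i : V, w c) * ∏ e ∈ G.edgeFinset, (1 + ∏ i, (if i ∈ e then r c else 1))
        = w c ^ Fintype.card V * (1 + r c ^ 2) ^ G.edgeFinset.card := by
    intro c
    rw [Finset.prod_const, Finset.card_univ]
    congr 1
    refine Finset.prod_eq_pow_card fun e he => ?_
    induction e with
    | _ u v =>
      have hadj : G.Adj u v := by simpa using he
      rw [prod_ite_mem_sym2 (fun _ => r c) hadj.ne, sq]
  have hne : (fun _ : V => true) ≠ fun _ => false := fun h => by
    simpa using congrFun h v₀
  rw [← Finset.sum_subset (Finset.subset_univ {fun _ : V => true, fun _ => false}),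
    Finset.sum_pair hne, hconst true, hconst false]
  · simp [w, r]
  · intro σ _ hσ
    have hex : ∃ u v, G.Adj u v ∧ σ u ≠ σ v := by
      by_contra! hcon
      apply hσ
      have heq : σ = fun _ => σ v₀ := funext fun i => hconn.eq_of_forall_adj_eq hcon i v₀
      rw [heq]
      cases σ v₀ <;> simp
    obtain ⟨u, v, hadj, hdiff⟩ := hex
    refine mul_eq_zero_of_right _ (Finset.prod_eq_zero (i := s(u, v)) (by simpa using hadj) ?_)
    rw [prod_ite_mem_sym2 (fun i => r (σ i)) hadj.ne]
    cases hu : σ u <;> cases hv : σ v <;> simp_all [r] <;> linarith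

theorem card_filter_degIn_eq_sum {V : Type*} [Fintype V] [DecidableEq V]
    (S : Finset (Finset (Sym2 V))) :
    ((S.filter (fun s => ∀ i : V, degIn s i ≠ 1)).card : ℝ)
      = ∑ s ∈ S, ∏ i, (if degIn s i ≠ 1 then (1 : ℝ) else 0) := by
  simp_rw [Finset.prod_boole]
  simp

theorem pow_mul_pow_eq_zpow_sub {p c : ℝ} (hc : c ≠ 0) (hpc : p * c = 1) (k m : ℕ) :
    p ^ k * c ^ m = c ^ ((m : ℤ) - (k : ℤ)) := by
  rw [zpow_sub₀ hc, zpow_natCast, zpow_natCast, eq_inv_of_mul_eq_one_left hpc, inv_pow,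
    div_eq_mul_inv, mul_comm]

/-- A combination of powers of the roots of `X ^ 2 = X + 1` with initial values `1, 0` dominates
the indicator of `k ≠ 1`. -/
theorem ite_ne_one_le_of_recurrence (F : ℕ → ℝ) (h0 : F 0 = 1) (h1 : F 1 = 0)
    (hF : ∀ k, F (k + 2) = F (k + 1) + F k) (k : ℕ) :
    (if k ≠ 1 then (1 : ℝ) else 0) ≤ F k := by
  have hpos : ∀ k, 1 ≤ F (k + 2) ∧ 1 ≤ F (k + 3) := by
    intro k
    induction k with
    | zero =>
      have h2 := hF 0
      have h3 := hF 1
      norm_num at h2 h3 ⊢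
      constructor <;> linarith
    | succ k ih =>
      have h := hF (k + 2)
      exact ⟨ih.2, by rw [show k + 1 + 3 = k + 2 + 2 by ring, h]; linarith [ih.1, ih.2]⟩
  match k with
  | 0 => simp [h0]
  | 1 => simp [h1]
  | k + 2 => simpa using (hpos k).1

theorem sub_coregraph_count_bounds {V : Type*} [Fintype V] [DecidableEq V]
    (G : SimpleGraph V) [DecidableRel G.Adj] (hconn : G.Connected)
    (n : ℤ) (hn : n = (G.edgeFinset.card : ℤ) - (Fintype.card V : ℤ) + 1) :
    (2 : ℝ) ^ n
        ≤ ((G.edgeFinset.powerset.filter (fun s => ∀ i : V, degIn s i ≠ 1)).card : ℝ) ∧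
    ((G.edgeFinset.powerset.filter (fun s => ∀ i : V, degIn s i ≠ 1)).card : ℝ)
        ≤ ((5 - Real.sqrt 5) / 2) ^ (n - 1) + ((5 + Real.sqrt 5) / 2) ^ (n - 1) := by
  have hn1 : n - 1 = (G.edgeFinset.card : ℤ) - (Fintype.card V : ℤ) := by omega
  rw [card_filter_degIn_eq_sum]
  constructor
  · have key := sum_prod_add_pow_degIn G hconn (1 / 2) (1 / 2) 1 (-1) (by norm_num)
    norm_num only [one_pow, neg_one_sq] at key
    rw [pow_mul_pow_eq_zpow_sub (by norm_num) (by norm_num), ← hn1] at key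
    have h2 : (2 : ℝ) ^ n = 2 ^ (n - 1) + 2 ^ (n - 1) := by
      rw [← two_mul, ← zpow_one_add₀ (by norm_num)]
      congr 1
      ring
    rw [h2, ← key]
    refine Finset.sum_le_sum fun s _ => Finset.prod_le_prod (fun i _ => ?_) fun i _ => ?_
    · rcases neg_one_pow_eq_or ℝ (degIn s i) with h | h <;> norm_num [h]
    · split_ifs with h
      · rcases neg_one_pow_eq_or ℝ (degIn s i) with h | h <;> norm_num [h]
      · norm_num [not_not.mp h]
  · have h5 : Real.sqrt 5 ^ 2 = 5 := Real.sq_sqrt (by norm_num)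
    have hpos : 0 < Real.sqrt 5 := Real.sqrt_pos.mpr (by norm_num)
    have hlt : Real.sqrt 5 < 5 := by nlinarith
    set t := Real.sqrt 5
    have key := sum_prod_add_pow_degIn G hconn ((5 + t) / 10) ((5 - t) / 10)
      ((1 - t) / 2) ((1 + t) / 2) (by linarith)
    rw [show 1 + ((1 - t) / 2) ^ 2 = (5 - t) / 2 by linarith,
      show 1 + ((1 + t) / 2) ^ 2 = (5 + t) / 2 by linarith,
      pow_mul_pow_eq_zpow_sub (by linarith) (by linarith),
      pow_mul_pow_eq_zpow_sub (by linarith) (by linarith), ← hn1] at key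
    rw [← key]
    refine Finset.sum_le_sum fun s _ => Finset.prod_le_prod (fun i _ => ?_) fun i _ => ?_
    · split_ifs <;> norm_num
    · refine ite_ne_one_le_of_recurrence
        (fun k => (5 + t) / 10 * ((1 - t) / 2) ^ k + (5 - t) / 10 * ((1 + t) / 2) ^ k)
        (by ring) (by linarith) (fun k => ?_) _
      have hx : ((1 - t) / 2) ^ 2 = (1 - t) / 2 + 1 := by linarith
      have hy : ((1 + t) / 2) ^ 2 = (1 + t) / 2 + 1 := by linarith
      simp only [pow_add, hx, hy, pow_one]
      ring
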